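/- arXiv:math-ph/0110001 — 3 statements merged into one kernel-verified Lean document; each statement's English description precedes it below -/
import Mathlib

section
/- The indefinite inner product is determined up to a real factor by its compatibility with the Clifford action: if B : ℂ^d × ℂ^d → ℂ is any nondegenerate hermitian sesquilinear form satisfying B(γ(v)u, w) = (−1)^k B(u, γ(v)w) for all v ∈ ℝⁿ and u, w ∈ ℂ^d, then there is a nonzero real number c such that B(u, w) = c · (u, w) for all u, w ∈ ℂ^d. -/
open Matrix

/-- If `a` commutes with each factor up to a scalar, it commutes with the product up to the
product of these scalars. -/
theorem List.mul_prod_map_eq_smul {R A ι : Type*} [CommRing R] [Ring A] [Algebra R A]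
    (a : A) (f : ι → A) (s : ι → R) (h : ∀ j, a * f j = s j • (f j * a)) (l : List ι) :
    a * (l.map f).prod = (l.map s).prod • ((l.map f).prod * a) := by
  induction l with
  | nil => simp
  | cons j l ih =>
    simp only [List.map_cons, List.prod_cons]
    rw [← mul_assoc, h, smul_mul_assoc, mul_assoc, ih, mul_smul_comm, smul_smul, mul_assoc]

/-- The adjoint of a product of pairwise anticommuting skew-adjoint elements. -/
theorem star_prod_ofFn_of_anticommute {R A : Type*} [CommRing R] [Ring A] [Algebra R A]
    [StarRing A] (k : ℕ) (f : Fin k → A) (hskew : ∀ j, star (f j) = -f j)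
    (hanti : ∀ i j, i ≠ j → f i * f j = -(f j * f i)) :
    star (List.ofFn f).prod = (-1 : R) ^ (k * (k + 1) / 2) • (List.ofFn f).prod := by
  induction k with
  | zero => simp
  | succ k ih =>
    have hcomm := List.mul_prod_map_eq_smul (R := R) (f (Fin.last k)) (fun j : Fin k => f j.castSucc)
      (fun _ => -1) (fun j => by
        rw [neg_one_smul]; exact hanti _ _ (Fin.castSucc_lt_last j).ne') (List.finRange k)
    rw [← List.ofFn_eq_map] at hcomm
    have hexp : (k + 1) * (k + 1 + 1) / 2 = k * (k + 1) / 2 + k + 1 := by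
      rw [show (k + 1) * (k + 1 + 1) = k * (k + 1) + (k + 1) * 2 by ring,
        Nat.add_mul_div_right _ _ two_pos, add_assoc]
    rw [List.ofFn_succ_last, List.prod_append, List.prod_singleton, star_mul, hskew,
      ih _ (fun j => hskew _)
        (fun i j hij => hanti _ _ fun h => hij (Fin.castSucc_injective k h)),
      mul_smul_comm, neg_mul, hcomm, hexp]
    simp [smul_smul, pow_add]

/-- A product of unitary elements is unitary. -/
theorem List.star_prod_mul_prod_eq_one {A : Type*} [Ring A] [StarRing A] (l : List A)
    (h : ∀ a ∈ l, star a * a = 1) : star l.prod * l.prod = 1 := by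
  induction l with
  | nil => simp
  | cons a l ih =>
    rw [List.prod_cons, star_mul, mul_assoc, ← mul_assoc (star a), h a (by simp), one_mul]
    exact ih fun b hb => h b (by simp [hb])

/-- A matrix commuting with a generating set of the full matrix algebra is scalar. -/
theorem Matrix.exists_eq_smul_one_of_commute_generators {R m : Type*} [CommRing R] [Fintype m]
    [DecidableEq m] {s : Set (Matrix m m R)} (hs : Algebra.adjoin R s = ⊤) (M : Matrix m m R)
    (hM : ∀ a ∈ s, a * M = M * a) : ∃ c : R, M = c • (1 : Matrix m m R) := by
  have hle : Algebra.adjoin R s ≤ Subalgebra.centralizer R {M} :=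
    Algebra.adjoin_le fun a ha => by
      rw [SetLike.mem_coe, Subalgebra.mem_centralizer_iff]
      rintro _ rfl
      exact (hM a ha).symm
  obtain ⟨c, hc⟩ := Matrix.mem_range_scalar_iff_commute_single'.mpr fun i j => by
    have := hle (hs ▸ Algebra.mem_top : Matrix.single i j (1 : R) ∈ _)
    exact ((Subalgebra.mem_centralizer_iff R).mp this M rfl).symm
  exact ⟨c, by rw [← hc, Matrix.smul_one_eq_diagonal]; rfl⟩

/-- A sesquilinear form on `ℂ^d` is given by a matrix. -/
theorem exists_matrix_of_sesquilinear {m : Type*} [Fintype m] [DecidableEq m]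
    (B : (m → ℂ) → (m → ℂ) → ℂ)
    (h₁ : ∀ (c : ℂ) (u u' w : m → ℂ), B (c • u + u') w = (starRingEnd ℂ) c * B u w + B u' w)
    (h₂ : ∀ (c : ℂ) (u w w' : m → ℂ), B u (c • w + w') = c * B u w + B u w') :
    ∃ H : Matrix m m ℂ, ∀ u w, B u w = star u ⬝ᵥ (H *ᵥ w) := by
  have z₁ (w) : B 0 w = 0 := by simpa using h₁ 1 0 0 w
  have z₂ (u) : B u 0 = 0 := by simpa using h₂ 1 u 0 0
  let b : (m → ℂ) →ₛₗ[starRingEnd ℂ] (m → ℂ) →ₗ[ℂ] ℂ :=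
    LinearMap.mk₂'ₛₗ (starRingEnd ℂ) (RingHom.id ℂ) B
      (fun u u' w => by simpa using h₁ 1 u u' w)
      (fun c u w => by simpa [z₁] using h₁ c u 0 w)
      (fun u w w' => by simpa using h₂ 1 u w w')
      (fun c u w => by simpa [z₂] using h₂ c u w 0)
  refine ⟨LinearMap.toMatrixₛₗ₂' ℂ b, fun u w => ?_⟩
  change b u w = _
  have hb : Matrix.toLinearMapₛₗ₂' ℂ (starRingEnd ℂ) (RingHom.id ℂ)
      (LinearMap.toMatrixₛₗ₂' ℂ b) = b := (LinearMap.toMatrixₛₗ₂' ℂ).symm_apply_apply b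
  conv_lhs => rw [← hb]
  rw [Matrix.toLinearMapₛₗ₂'_apply]
  simp only [dotProduct, mulVec, Finset.mul_sum, Pi.star_apply, RingHom.id_apply, smul_eq_mul]
  refine Finset.sum_congr rfl fun i _ => Finset.sum_congr rfl fun j _ => ?_
  rw [starRingEnd_apply]
  ring

/-- The matrix of a sesquilinear form is determined by the form. -/
theorem Matrix.ext_of_star_dotProduct_mulVec {m : Type*} [Fintype m] [DecidableEq m]
    {M N : Matrix m m ℂ} (h : ∀ u w, star u ⬝ᵥ (M *ᵥ w) = star u ⬝ᵥ (N *ᵥ w)) : M = N := by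
  ext i j
  simpa [← Pi.single_star] using h (Pi.single i 1) (Pi.single j 1)

/-- Moving a matrix across the standard hermitian inner product. -/
theorem Matrix.star_mulVec_dotProduct {m : Type*} [Fintype m] (M : Matrix m m ℂ) (u w : m → ℂ) :
    star (M *ᵥ u) ⬝ᵥ w = star u ⬝ᵥ (Mᴴ *ᵥ w) := by
  rw [Matrix.star_mulVec, Matrix.dotProduct_mulVec]



/-- The indefinite inner product is determined up to a nonzero
real factor by its compatibility with the Clifford action: any nondegenerate
hermitian sesquilinear form `B` with `B(γ(v)u, w) = (−1)^k B(u, γ(v)w)` is a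
nonzero real multiple of `(·,·)`. -/
theorem indefinite_inner_product_unique_up_to_real_factor
    (n k d : ℕ) (hn : 1 ≤ n) (hkn : k ≤ n) (hd : 1 ≤ d)
    (γ : Fin n → Matrix (Fin d) (Fin d) ℂ)
    (hcl : ∀ i j : Fin n, γ i * γ j + γ j * γ i =
      ((2 : ℂ) * (if i = j then (if (i : ℕ) < k then -1 else 1) else 0)) •
        (1 : Matrix (Fin d) (Fin d) ℂ))
    (hadj : ∀ i : Fin n, (γ i)ᴴ = if (i : ℕ) < k then -γ i else γ i)
    (hgen : Algebra.adjoin ℂ (Set.range γ) = (⊤ : Subalgebra ℂ (Matrix (Fin d) (Fin d) ℂ)))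
    (Gk : Matrix (Fin d) (Fin d) ℂ)
    (hGk : Gk = ((List.finRange k).map (fun j => γ (Fin.castLE hkn j))).prod)
    (krein : (Fin d → ℂ) → (Fin d → ℂ) → ℂ)
    (hkrein : ∀ u v : Fin d → ℂ, krein u v =
      (Complex.I ^ (k * (k + 1) / 2)) * ∑ i, (starRingEnd ℂ) (Gk.mulVec u i) * v i)
    (B : (Fin d → ℂ) → (Fin d → ℂ) → ℂ)
    (hsesq₁ : ∀ (c : ℂ) (u u' w : Fin d → ℂ),
      B (c • u + u') w = (starRingEnd ℂ) c * B u w + B u' w)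
    (hsesq₂ : ∀ (c : ℂ) (u w w' : Fin d → ℂ),
      B u (c • w + w') = c * B u w + B u w')
    (hherm : ∀ u w : Fin d → ℂ, B u w = (starRingEnd ℂ) (B w u))
    (hnondeg : ∀ u : Fin d → ℂ, (∀ w : Fin d → ℂ, B u w = 0) → u = 0)
    (hcompat : ∀ (v : Fin n → ℝ) (u w : Fin d → ℂ),
      B ((∑ i, (v i : ℂ) • γ i).mulVec u) w =
        (-1 : ℂ) ^ k * B u ((∑ i, (v i : ℂ) • γ i).mulVec w)) :
    ∃ c : ℝ, c ≠ 0 ∧ ∀ u w : Fin d → ℂ, B u w = (c : ℂ) * krein u w := by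
  have hofFn : Gk = (List.ofFn fun j => γ (Fin.castLE hkn j)).prod := by
    rw [hGk, List.ofFn_eq_map]
  have hanti : ∀ i j, i ≠ j → γ i * γ j = -(γ j * γ i) := fun i j hij => by
    have h := hcl i j
    simp only [hij, if_false, mul_zero, zero_smul] at h
    exact eq_neg_of_add_eq_zero_left h
  have hskew : ∀ j : Fin k, (γ (Fin.castLE hkn j))ᴴ = -γ (Fin.castLE hkn j) := fun j => by
    rw [hadj, if_pos (by simp)]
  have hGstar : Gkᴴ = (-1 : ℂ) ^ (k * (k + 1) / 2) • Gk := by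
    rw [hofFn]
    exact star_prod_ofFn_of_anticommute k _ hskew fun i j hij =>
      hanti _ _ fun h => hij (Fin.castLE_injective hkn h)
  have hunit : Gkᴴ * Gk = 1 := by
    rw [hGk]
    refine List.star_prod_mul_prod_eq_one _ fun a ha => ?_
    obtain ⟨j, -, rfl⟩ := List.mem_map.mp ha
    have h := hcl (Fin.castLE hkn j) (Fin.castLE hkn j)
    simp only [if_true, Fin.val_castLE, j.isLt, ← two_smul ℂ, mul_smul] at h
    rw [star_eq_conjTranspose, hskew, neg_mul, smul_right_injective _ two_ne_zero h]
    simp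
  have hγG : ∀ i, Gk * (γ i)ᴴ = (-1 : ℂ) ^ k • (γ i * Gk) := fun i => by
    have h := List.mul_prod_map_eq_smul (γ i) (fun j => γ (Fin.castLE hkn j))
      (fun j => (-1 : ℂ) * if Fin.castLE hkn j = i then -1 else 1)
      (fun j => by
        by_cases hj : Fin.castLE hkn j = i
        · simp [hj]
        · simp [hj, hanti i _ (Ne.symm hj)]) (List.finRange k)
    have hs : ((List.finRange k).map
        fun j => (-1 : ℂ) * if Fin.castLE hkn j = i then -1 else 1).prod =
        (-1) ^ k * if (i : ℕ) < k then -1 else 1 := by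
      rw [← List.ofFn_eq_map, List.prod_ofFn, Finset.prod_mul_distrib]
      congr 1
      · simp
      · split_ifs with hi
        · rw [Finset.prod_eq_single ⟨i, hi⟩]
          · simp
          · intro j _ hj
            rw [if_neg]
            simpa [Fin.ext_iff] using hj
          · simp
        · refine Finset.prod_eq_one fun j _ => if_neg ?_
          rintro rfl
          exact hi j.isLt
    rw [← hGk, hs] at h
    rw [h, hadj, smul_smul, ← mul_assoc, ← mul_pow]
    split_ifs <;> simp
  obtain ⟨H, hH⟩ := exists_matrix_of_sesquilinear B hsesq₁ hsesq₂
  have hHherm : Hᴴ = H := Matrix.ext_of_star_dotProduct_mulVec fun u w => by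
    rw [← hH, hherm, hH, ← Matrix.star_mulVec_dotProduct, starRingEnd_apply,
      ← Matrix.star_dotProduct_star, star_star, dotProduct_comm]
  have hHγ : ∀ i, (γ i)ᴴ * H = (-1 : ℂ) ^ k • (H * γ i) := fun i =>
    Matrix.ext_of_star_dotProduct_mulVec fun u w => by
      have h := hcompat (Pi.single i 1) u w
      have hsum : ∑ j, ((Pi.single i (1 : ℝ) : Fin n → ℝ) j : ℂ) • γ j = γ i := by
        rw [Finset.sum_eq_single i] <;> simp +contextual
      rw [hsum, hH, hH, Matrix.star_mulVec_dotProduct] at h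
      simpa [Matrix.smul_mulVec, Matrix.mulVec_mulVec] using h
  have hsq : (-1 : ℂ) ^ k * (-1) ^ k = 1 := by simp [← mul_pow]
  obtain ⟨c₀, hc₀⟩ := Matrix.exists_eq_smul_one_of_commute_generators hgen (Gk * H) (by
    rintro _ ⟨i, rfl⟩
    have h₁ : γ i * Gk = (-1 : ℂ) ^ k • (Gk * (γ i)ᴴ) := by rw [hγG, smul_smul, hsq, one_smul]
    rw [← mul_assoc, h₁, smul_mul_assoc, mul_assoc, hHγ, mul_smul_comm, smul_smul, hsq, one_smul,
      mul_assoc])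
  set m := k * (k + 1) / 2
  have hI : Complex.I ^ m ≠ 0 := pow_ne_zero _ Complex.I_ne_zero
  set K : Matrix (Fin d) (Fin d) ℂ := Complex.I ^ m • Gkᴴ with hK
  have hKherm : Kᴴ = K := by
    rw [hK, conjTranspose_smul, conjTranspose_conjTranspose, hGstar, smul_smul, ← mul_pow]
    simp
  obtain ⟨c, hHK⟩ : ∃ c : ℂ, H = c • K := by
    refine ⟨c₀ * (Complex.I ^ m)⁻¹, ?_⟩
    rw [hK, smul_smul, inv_mul_cancel_right₀ hI, ← one_mul H, ← hunit, mul_assoc, hc₀]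
    simp
  have hH0 : H ≠ 0 := by
    rintro rfl
    have h := hnondeg (Pi.single ⟨0, hd⟩ 1) fun w => by simp [hH]
    simpa using congrFun h ⟨0, hd⟩
  have hc : c ≠ 0 := by rintro rfl; exact hH0 (by simp [hHK])
  have hK0 : K ≠ 0 := by rintro h; exact hH0 (by simp [hHK, h])
  have hreal : (starRingEnd ℂ) c = c := by
    have h := hHherm
    rw [hHK, conjTranspose_smul, hKherm] at h
    exact smul_left_injective ℂ hK0 h
  obtain ⟨r, rfl⟩ := Complex.conj_eq_iff_real.mp hreal
  refine ⟨r, by exact_mod_cast hc, fun u w => ?_⟩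
  have hkr : krein u w = star u ⬝ᵥ (K *ᵥ w) := by
    rw [hkrein, hK, Matrix.smul_mulVec, dotProduct_smul, ← Matrix.star_mulVec_dotProduct]
    rfl
  rw [hkr, hH, hHK, Matrix.smul_mulVec, dotProduct_smul, smul_eq_mul]
end

section
/- Let r be a spacelike reflection and J_r := i^{k(k+1)/2} γ(f₁)⋯γ(f_k) for a basis f₁, …, f_k of the (−1)-eigenspace of r with q(fᵢ, fⱼ) = −δᵢⱼ. Then J_r² = 1, (J_r u, v) = (u, J_r v) for all u, v (J_r is Krein-selfadjoint), and J_r γ(v) J_r = (−1)^k γ(rv) for all v ∈ ℝⁿ. Moreover, after possibly replacing f₁ by −f₁ (i.e. for a suitable orientation of the basis), the form (u, J_r u) is positive definite, so J_r is a fundamental symmetry of the Krein space (ℂ^d, (·,·)). -/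
open Matrix

section ListProd

variable {R : Type*} [Ring R] [Algebra ℂ R]

theorem List.prod_mul_of_anticomm (x : R) (l : List R) (h : ∀ a ∈ l, a * x = -(x * a)) :
    l.prod * x = (-1 : ℂ) ^ l.length • (x * l.prod) := by
  induction l with
  | nil => simp
  | cons a l ih =>
    have ha := h a (by simp)
    rw [List.prod_cons, mul_assoc, ih fun b hb => h b (by simp [hb]), mul_smul_comm, ← mul_assoc,
      ha, List.length_cons, pow_succ, neg_mul, mul_assoc]
    simp

theorem List.prod_mul_of_mem_of_anticomm (x : R) (l : List R)
    (h : l.Pairwise fun a b => a * b = -(b * a)) (hx : x ∈ l) :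
    l.prod * x = -((-1 : ℂ) ^ l.length • (x * l.prod)) := by
  induction l with
  | nil => simp at hx
  | cons a l ih =>
    rw [List.pairwise_cons] at h
    rcases List.mem_cons.1 hx with rfl | hx
    · rw [List.prod_cons, mul_assoc, List.prod_mul_of_anticomm x l fun b hb => by
        rw [h.1 b hb, neg_neg], mul_smul_comm, List.length_cons, pow_succ]
      simp
    · rw [List.prod_cons, mul_assoc, ih h.2 hx, mul_neg, mul_smul_comm, ← mul_assoc, h.1 x hx,
        List.length_cons, pow_succ, neg_mul, mul_assoc]
      simp

theorem List.prod_reverse_of_anticomm (l : List R)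
    (h : l.Pairwise fun a b => a * b = -(b * a)) :
    l.reverse.prod = (-1 : ℂ) ^ l.length.choose 2 • l.prod := by
  induction l with
  | nil => simp
  | cons a l ih =>
    rw [List.pairwise_cons] at h
    rw [List.reverse_cons, List.prod_append, List.prod_singleton, ih h.2, smul_mul_assoc,
      List.prod_mul_of_anticomm a l fun b hb => by rw [h.1 b hb, neg_neg], smul_smul, ← pow_add,
      List.prod_cons, List.length_cons, Nat.choose_succ_succ' l.length 1, Nat.choose_one_right,
      add_comm]

theorem List.prod_mul_prod_reverse_of_sq_eq_neg_one (l : List R) (h : ∀ a ∈ l, a * a = -1) :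
    l.prod * l.reverse.prod = (-1 : ℂ) ^ l.length • 1 := by
  induction l with
  | nil => simp
  | cons a l ih =>
    rw [List.reverse_cons, List.prod_append, List.prod_singleton, List.prod_cons, mul_assoc,
      ← mul_assoc l.prod, ih fun b hb => h b (by simp [hb]), smul_mul_assoc, one_mul,
      mul_smul_comm, h a (by simp), List.length_cons, pow_succ]
    simp

theorem List.prod_mul_self_of_anticomm (l : List R)
    (h : l.Pairwise fun a b => a * b = -(b * a)) (hs : ∀ a ∈ l, a * a = -1) :
    l.prod * l.prod = (-1 : ℂ) ^ (l.length * (l.length + 1) / 2) • 1 := by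
  have h1 := List.prod_mul_prod_reverse_of_sq_eq_neg_one l hs
  rw [List.prod_reverse_of_anticomm l h, mul_smul_comm] at h1
  have h2 := congrArg ((-1 : ℂ) ^ l.length.choose 2 • ·) h1
  simp only [smul_smul, ← mul_pow, ← pow_add] at h2
  have h3 : l.length * (l.length + 1) / 2 = l.length.choose 2 + l.length := by
    rw [Nat.choose_two_right, ← Nat.triangle_succ, Nat.add_sub_cancel, mul_comm]
  rw [h3, ← h2]
  simp

end ListProd

section Reflection

variable {V R : Type*} [AddCommGroup V] [Module ℝ V] [Ring R] [Algebra ℂ R]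
  {k : ℕ} {g : V →ₛₗ[Complex.ofRealHom] R} {q : V → V → ℝ} {f : Fin k → V}

theorem pairwise_anticomm_of_orthonormal
    (hg : ∀ u v, g u * g v + g v * g u = (2 * (q u v : ℂ)) • (1 : R))
    (hf : ∀ i j, q (f i) (f j) = if i = j then -1 else 0) :
    ((List.finRange k).map fun j => g (f j)).Pairwise fun a b => a * b = -(b * a) := by
  rw [List.pairwise_map]
  refine (List.nodup_finRange k).imp fun {i j} hij => ?_
  have := hg (f i) (f j)
  rw [hf, if_neg hij] at this
  exact eq_neg_of_add_eq_zero_left (by simpa using this)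

theorem sq_eq_neg_one_of_orthonormal
    (hg : ∀ u v, g u * g v + g v * g u = (2 * (q u v : ℂ)) • (1 : R))
    (hf : ∀ i j, q (f i) (f j) = if i = j then -1 else 0) :
    ∀ a ∈ (List.finRange k).map fun j => g (f j), a * a = -1 := by
  intro a ha
  obtain ⟨j, -, rfl⟩ := List.mem_map.1 ha
  have := hg (f j) (f j)
  rw [hf, if_pos rfl, ← two_smul ℂ, mul_smul] at this
  have h2 := smul_right_injective R (two_ne_zero (α := ℂ)) this
  simpa using h2

theorem prod_mul_prod_of_orthonormal
    (hg : ∀ u v, g u * g v + g v * g u = (2 * (q u v : ℂ)) • (1 : R))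
    (hf : ∀ i j, q (f i) (f j) = if i = j then -1 else 0) :
    ((List.finRange k).map fun j => g (f j)).prod * ((List.finRange k).map fun j => g (f j)).prod =
      (-1 : ℂ) ^ (k * (k + 1) / 2) • 1 := by
  simpa using List.prod_mul_self_of_anticomm _ (pairwise_anticomm_of_orthonormal hg hf)
    (sq_eq_neg_one_of_orthonormal hg hf)

theorem I_pow_sq (m : ℕ) : Complex.I ^ m * Complex.I ^ m = (-1) ^ m := by
  rw [← mul_pow, Complex.I_mul_I]

/-- The operator `J` squares to one. -/
theorem smul_prod_sq
    (hg : ∀ u v, g u * g v + g v * g u = (2 * (q u v : ℂ)) • (1 : R))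
    (hf : ∀ i j, q (f i) (f j) = if i = j then -1 else 0) {J : R}
    (hJ : J = Complex.I ^ (k * (k + 1) / 2) • ((List.finRange k).map fun j => g (f j)).prod) :
    J * J = 1 := by
  rw [hJ, smul_mul_smul_comm, prod_mul_prod_of_orthonormal hg hf, I_pow_sq, smul_smul, ← mul_pow]
  simp

/-- The operator `J` intertwines `γ(v)` with `(-1)^k γ(r v)`. -/
theorem smul_prod_mul
    (hg : ∀ u v, g u * g v + g v * g u = (2 * (q u v : ℂ)) • (1 : R))
    (hqneg : ∀ u v, q (-u) v = -q u v)
    (hf : ∀ i j, q (f i) (f j) = if i = j then -1 else 0)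
    (r : V →ₗ[ℝ] V) (hr2 : ∀ v, r (r v) = v) (hrq : ∀ u v, q (r u) (r v) = q u v)
    (hfeig : ∀ j, r (f j) = -(f j))
    (hfspan : ∀ v, r v = -v → v ∈ Submodule.span ℝ (Set.range f)) {J : R}
    (hJ : J = Complex.I ^ (k * (k + 1) / 2) • ((List.finRange k).map fun j => g (f j)).prod)
    (v : V) : J * g v = (-1 : ℂ) ^ k • (g (r v) * J) := by
  have hneg : ∀ v ∈ Submodule.span ℝ (Set.range f), J * g v = (-1 : ℂ) ^ k • (g (r v) * J) := by
    intro v hv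
    induction hv using Submodule.span_induction with
    | mem x hx =>
      obtain ⟨j, rfl⟩ := hx
      have := List.prod_mul_of_mem_of_anticomm (g (f j)) _
        (pairwise_anticomm_of_orthonormal hg hf) (List.mem_map.2 ⟨j, List.mem_finRange j, rfl⟩)
      rw [hJ, smul_mul_assoc, this, hfeig, map_neg, mul_smul_comm, smul_comm]
      simp
    | zero => simp
    | add x y _ _ hx hy => rw [map_add, map_add, map_add, mul_add, hx, hy, add_mul, smul_add]
    | smul a x _ hx =>
      rw [map_smulₛₗ, map_smul, map_smulₛₗ, mul_smul_comm, hx, smul_mul_assoc, smul_comm]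
  have hpos : ∀ v, r v = v → J * g v = (-1 : ℂ) ^ k • (g (r v) * J) := by
    intro v hv
    have := List.prod_mul_of_anticomm (g v) ((List.finRange k).map fun j => g (f j)) (by
      intro a ha
      obtain ⟨j, -, rfl⟩ := List.mem_map.1 ha
      have h0 : q (f j) v = 0 := by
        have h1 := hrq (f j) v
        rw [hfeig, hv, hqneg] at h1
        linarith
      have h2 := hg (f j) v
      rw [h0] at h2
      exact eq_neg_of_add_eq_zero_left (by simpa using h2))
    rw [hJ, hv, smul_mul_assoc, this, mul_smul_comm, smul_comm]
    simp
  have hadd : ∀ a b, J * g a = (-1 : ℂ) ^ k • (g (r a) * J) → J * g b = (-1 : ℂ) ^ k • (g (r b) * J) →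
      J * g (a + b) = (-1 : ℂ) ^ k • (g (r (a + b)) * J) := fun a b ha hb => by
    rw [map_add, map_add, map_add, mul_add, ha, hb, add_mul, smul_add]
  have h1 := hadd _ _ (hneg (v - r v) (hfspan _ (by rw [map_sub, hr2]; abel)))
    (hpos (v + r v) (by rw [map_add, hr2]; abel))
  rw [sub_add_add_cancel, ← two_smul ℝ v, map_smulₛₗ, map_smul, map_smulₛₗ, mul_smul_comm,
    smul_mul_assoc, smul_comm] at h1
  exact smul_right_injective R (by simp : Complex.ofRealHom 2 ≠ 0) h1

end Reflection

open scoped ComplexOrder in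
theorem Matrix.PosDef.re_pos_and_im_eq_zero {d : ℕ} {P : Matrix (Fin d) (Fin d) ℂ} (hP : P.PosDef)
    {u : Fin d → ℂ} (hu : u ≠ 0) : 0 < (star u ⬝ᵥ (P *ᵥ u)).re ∧ (star u ⬝ᵥ (P *ᵥ u)).im = 0 :=
  have h := Complex.pos_iff.1 (hP.dotProduct_mulVec_pos hu)
  ⟨h.1, h.2.symm⟩

open scoped ComplexOrder in
/-- A Hermitian matrix that commutes, up to positive scalars, with a family of generators of the
full matrix algebra is definite. -/
theorem Matrix.IsHermitian.posDef_or_neg_posDef {d : ℕ} {P : Matrix (Fin d) (Fin d) ℂ}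
    (hP : P.IsHermitian) (hinj : ∀ u, P *ᵥ u = 0 → u = 0) {ι : Type*}
    (m : ι → Matrix (Fin d) (Fin d) ℂ) (hm : Algebra.adjoin ℂ (Set.range m) = ⊤)
    (a : ι → ℝ) (ha : ∀ i, 0 < a i) (hPm : ∀ i, P * m i = (a i : ℂ) • (m i * P)) :
    P.PosDef ∨ (-P).PosDef := by
  have key : ∀ s : ℝ, (∃ (u : Fin d → ℂ) (c : ℝ), u ≠ 0 ∧ 0 < s * c ∧ P *ᵥ u = (c : ℂ) • u) →
      ∀ (w : Fin d → ℂ) (c : ℝ), w ≠ 0 → P *ᵥ w = (c : ℂ) • w → 0 < s * c := by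
    rintro s ⟨u, c₀, hu, hc₀, hPu⟩ w c hw hPw
    by_contra hc
    let W : Submodule ℂ (Fin d → ℂ) :=
      Submodule.span ℂ {x | ∃ b : ℝ, 0 < s * b ∧ P *ᵥ x = (b : ℂ) • x}
    have hinv : ∀ A : Matrix (Fin d) (Fin d) ℂ, ∀ x ∈ W, A *ᵥ x ∈ W := by
      intro A
      have hA : A ∈ Algebra.adjoin ℂ (Set.range m) := by rw [hm]; trivial
      induction hA using Algebra.adjoin_induction with
      | mem y hy =>
        obtain ⟨i, rfl⟩ := hy
        intro x hx
        induction hx using Submodule.span_induction with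
        | mem x hx =>
          obtain ⟨b, hb, hx⟩ := hx
          refine Submodule.subset_span ⟨a i * b, ?_, ?_⟩
          · have := mul_pos (ha i) hb
            linarith
          · rw [mulVec_mulVec, hPm, smul_mulVec, ← mulVec_mulVec, hx, mulVec_smul, smul_smul]
            push_cast
            rfl
        | zero => simp
        | add x y _ _ hx hy => rw [mulVec_add]; exact W.add_mem hx hy
        | smul t x _ hx => rw [mulVec_smul]; exact W.smul_mem t hx
      | algebraMap t =>
        intro x hx
        rw [Algebra.algebraMap_eq_smul_one, smul_mulVec, one_mulVec]
        exact W.smul_mem t hx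
      | add A B _ _ hA hB => intro x hx; rw [add_mulVec]; exact W.add_mem (hA x hx) (hB x hx)
      | mul A B _ _ hA hB => intro x hx; rw [← mulVec_mulVec]; exact hA _ (hB x hx)
    have huW : u ∈ W := Submodule.subset_span ⟨c₀, hc₀, hPu⟩
    have hwW : w ∈ W := by
      have h0 : star u ⬝ᵥ u ≠ 0 := fun h => hu (dotProduct_star_self_eq_zero.1 h)
      have := W.smul_mem (star u ⬝ᵥ u)⁻¹ (hinv (vecMulVec w (star u)) u huW)
      rw [vecMulVec_mulVec] at this
      simpa [smul_smul, h0] using this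
    have horth : ∀ x ∈ W, star w ⬝ᵥ x = 0 := by
      intro x hx
      induction hx using Submodule.span_induction with
      | mem x hx =>
        obtain ⟨b, hb, hx⟩ := hx
        have h1 : star w ⬝ᵥ (P *ᵥ x) = star (P *ᵥ w) ⬝ᵥ x := by
          rw [star_mulVec, hP.eq, dotProduct_mulVec]
        rw [hx, hPw, dotProduct_smul, star_smul, smul_dotProduct] at h1
        have h2 : ((b : ℂ) - c) * (star w ⬝ᵥ x) = 0 := by
          simp only [smul_eq_mul, RCLike.star_def, Complex.conj_ofReal] at h1
          linear_combination h1
        refine (mul_eq_zero.1 h2).resolve_left fun h => hc ?_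
        rw [sub_eq_zero, Complex.ofReal_inj] at h
        rwa [← h]
      | zero => simp
      | add x y _ _ hx hy => rw [dotProduct_add, hx, hy, add_zero]
      | smul t x _ hx => rw [dotProduct_smul, hx, smul_zero]
    exact hw (dotProduct_star_self_eq_zero.1 (horth w hwW))
  have hev : ∀ i, P *ᵥ ⇑(hP.eigenvectorBasis i) =
      (hP.eigenvalues i : ℂ) • ⇑(hP.eigenvectorBasis i) := fun i => by
    rw [hP.mulVec_eigenvectorBasis i]
    rfl
  have hne : ∀ i, (⇑(hP.eigenvectorBasis i) : Fin d → ℂ) ≠ 0 := fun i h =>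
    hP.eigenvectorBasis.orthonormal.ne_zero i (by ext j; exact congrFun h j)
  rcases isEmpty_or_nonempty (Fin d) with hd | ⟨⟨i₀⟩⟩
  · exact Or.inl (hP.posDef_iff_eigenvalues_pos.2 fun i => hd.elim i)
  have h0 : hP.eigenvalues i₀ ≠ 0 := fun h => hne i₀ (hinj _ (by rw [hev, h]; simp))
  rcases lt_or_gt_of_ne h0 with h | h
  · right
    refine hP.neg.posDef_iff_eigenvalues_pos.2 fun i => ?_
    have h1 := key (-1) ⟨_, _, hne i₀, by linarith, hev i₀⟩
      (hP.neg.eigenvectorBasis i) (-hP.neg.eigenvalues i)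
      (fun h => hP.neg.eigenvectorBasis.orthonormal.ne_zero i (by ext j; exact congrFun h j)) (by
        have := hP.neg.mulVec_eigenvectorBasis i
        rw [neg_mulVec, neg_eq_iff_eq_neg] at this
        rw [this]
        ext j
        simp)
    linarith
  · left
    refine hP.posDef_iff_eigenvalues_pos.2 fun i => ?_
    simpa using key 1 ⟨_, _, hne i₀, by linarith, hev i₀⟩ _ _ (hne i) (hev i)

/-- The Clifford map `v ↦ ∑ vᵢ γᵢ`. -/
def cliffordMap {n d : ℕ} (γ : Fin n → Matrix (Fin d) (Fin d) ℂ) :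
    (Fin n → ℝ) →ₛₗ[Complex.ofRealHom] Matrix (Fin d) (Fin d) ℂ where
  toFun v := ∑ i, (v i : ℂ) • γ i
  map_add' u v := by simp [add_smul, Finset.sum_add_distrib]
  map_smul' a v := by simp [Finset.smul_sum, mul_smul]

theorem cliffordMap_apply {n d : ℕ} (γ : Fin n → Matrix (Fin d) (Fin d) ℂ) (v : Fin n → ℝ) :
    cliffordMap γ v = ∑ i, (v i : ℂ) • γ i := rfl

theorem cliffordMap_single {n d : ℕ} (γ : Fin n → Matrix (Fin d) (Fin d) ℂ) (i : Fin n) :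
    cliffordMap γ (Pi.single i 1) = γ i := by
  rw [cliffordMap_apply, Finset.sum_eq_single i] <;> simp +contextual

/-- The reflection that changes the sign of the first `k` coordinates. -/
def standardReflection (n k : ℕ) : (Fin n → ℝ) →ₗ[ℝ] (Fin n → ℝ) where
  toFun v i := if (i : ℕ) < k then -v i else v i
  map_add' u v := by ext i; simp only [Pi.add_apply]; split_ifs <;> ring
  map_smul' a v := by ext i; simp

theorem standardReflection_apply (n k : ℕ) (v : Fin n → ℝ) (i : Fin n) :
    standardReflection n k v i = if (i : ℕ) < k then -v i else v i := rfl

section Clifford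

variable {n k d : ℕ} {γ : Fin n → Matrix (Fin d) (Fin d) ℂ}

theorem cliffordMap_anticomm
    (hcl : ∀ i j : Fin n, γ i * γ j + γ j * γ i =
      ((2 : ℂ) * (if i = j then (if (i : ℕ) < k then -1 else 1) else 0)) •
        (1 : Matrix (Fin d) (Fin d) ℂ)) (u v : Fin n → ℝ) :
    cliffordMap γ u * cliffordMap γ v + cliffordMap γ v * cliffordMap γ u =
      (2 * ((∑ i : Fin n, if (i : ℕ) < k then -(u i * v i) else u i * v i : ℝ) : ℂ)) • 1 := by
  simp only [cliffordMap_apply]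
  rw [Finset.sum_mul_sum, Finset.sum_mul_sum, Finset.sum_comm (s := Finset.univ) (t := Finset.univ)
    (f := fun i j => ((v i : ℂ) • γ i) * ((u j : ℂ) • γ j)), ← Finset.sum_add_distrib,
    Complex.ofReal_sum, Finset.mul_sum, Finset.sum_smul]
  refine Finset.sum_congr rfl fun i _ => ?_
  rw [← Finset.sum_add_distrib, Finset.sum_eq_single i]
  · rw [smul_mul_smul_comm, smul_mul_smul_comm, mul_comm (v i : ℂ), ← smul_add, hcl, smul_smul,
      if_pos rfl]
    congr 1
    split_ifs <;> push_cast <;> ring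
  · intro j _ hj
    rw [smul_mul_smul_comm, smul_mul_smul_comm, mul_comm (v j : ℂ), ← smul_add, hcl,
      if_neg hj.symm]
    simp
  · simp

theorem conjTranspose_cliffordMap
    (hadj : ∀ i : Fin n, (γ i)ᴴ = if (i : ℕ) < k then -γ i else γ i) (v : Fin n → ℝ) :
    (cliffordMap γ v)ᴴ = cliffordMap γ (standardReflection n k v) := by
  simp only [cliffordMap_apply, conjTranspose_sum, conjTranspose_smul, hadj,
    standardReflection_apply]
  refine Finset.sum_congr rfl fun i _ => ?_
  split_ifs <;> simp

end Clifford

theorem mul_prod_eq_conjTranspose_mul {d : ℕ} (K : Matrix (Fin d) (Fin d) ℂ) (k : ℕ)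
    (l : List (Matrix (Fin d) (Fin d) ℂ)) (h : ∀ a ∈ l, K * a = (-1 : ℂ) ^ k • (aᴴ * K)) :
    K * l.prod = (-1 : ℂ) ^ (k * l.length) • (l.reverse.prodᴴ * K) := by
  induction l with
  | nil => simp
  | cons a l ih =>
    rw [List.prod_cons, ← mul_assoc, h a (by simp), smul_mul_assoc, mul_assoc,
      ih fun b hb => h b (by simp [hb]), List.reverse_cons, List.prod_append, List.prod_singleton,
      conjTranspose_mul, mul_smul_comm, smul_smul, ← pow_add, mul_assoc, List.length_cons]
    congr 2
    ring

/-- If `K` conjugates `γ(v)` to `(-1)^k γ(v)*`, then `J` is selfadjoint with respect to the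
sesquilinear form defined by `K`. -/
theorem mul_smul_prod_eq_conjTranspose_mul {d k : ℕ} {K J : Matrix (Fin d) (Fin d) ℂ}
    {l : List (Matrix (Fin d) (Fin d) ℂ)} (hl : l.length = k)
    (hK : ∀ a ∈ l, K * a = (-1 : ℂ) ^ k • (aᴴ * K))
    (h : l.Pairwise fun a b => a * b = -(b * a))
    (hJ : J = Complex.I ^ (k * (k + 1) / 2) • l.prod) :
    K * J = Jᴴ * K := by
  have h3 : k * (k + 1) / 2 = k.choose 2 + k := by
    rw [Nat.choose_two_right, ← Nat.triangle_succ, Nat.add_sub_cancel, mul_comm]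
  rw [hJ, mul_smul_comm, mul_prod_eq_conjTranspose_mul K k l hK, List.prod_reverse_of_anticomm l h,
    hl, conjTranspose_smul, conjTranspose_smul, smul_mul_assoc, smul_mul_assoc, smul_smul,
    smul_smul]
  congr 1
  have h4 : (-1 : ℂ) ^ (k * k) = (-1) ^ k := by
    rcases Nat.even_or_odd k with hk | hk
    · rw [hk.neg_one_pow, (hk.mul_left k).neg_one_pow]
    · rw [hk.neg_one_pow, (hk.mul hk).neg_one_pow]
  simp only [star_pow, star_neg, star_one, RCLike.star_def, Complex.conj_I]
  rw [h4, neg_pow Complex.I, h3, pow_add (-1 : ℂ)]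
  ring

/-- For a spacelike reflection `r`, the operator
`J_r := i^{k(k+1)/2} γ(f₁)⋯γ(f_k)` (for a `q`-orthonormal basis `f₁,…,f_k` of
the `(−1)`-eigenspace of `r`) satisfies `J_r² = 1`, is Krein-selfadjoint,
conjugates `γ(v)` to `(−1)^k γ(rv)`, and, after possibly replacing `f₁` by
`−f₁`, `(u, J_r u)` is positive definite, so `J_r` is a fundamental symmetry. -/
theorem spacelike_reflection_gives_fundamental_symmetry
    (n k d : ℕ) (hn : 1 ≤ n) (hkn : k ≤ n) (hd : 1 ≤ d)
    (q : (Fin n → ℝ) → (Fin n → ℝ) → ℝ)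
    (hq : ∀ x y : Fin n → ℝ, q x y = ∑ i : Fin n, if (i : ℕ) < k then -(x i * y i) else x i * y i)
    (γ : Fin n → Matrix (Fin d) (Fin d) ℂ)
    (hcl : ∀ i j : Fin n, γ i * γ j + γ j * γ i =
      ((2 : ℂ) * (if i = j then (if (i : ℕ) < k then -1 else 1) else 0)) •
        (1 : Matrix (Fin d) (Fin d) ℂ))
    (hadj : ∀ i : Fin n, (γ i)ᴴ = if (i : ℕ) < k then -γ i else γ i)
    (hgen : Algebra.adjoin ℂ (Set.range γ) = (⊤ : Subalgebra ℂ (Matrix (Fin d) (Fin d) ℂ)))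
    (Gk : Matrix (Fin d) (Fin d) ℂ)
    (hGk : Gk = ((List.finRange k).map (fun j => γ (Fin.castLE hkn j))).prod)
    (krein : (Fin d → ℂ) → (Fin d → ℂ) → ℂ)
    (hkrein : ∀ u v : Fin d → ℂ, krein u v =
      (Complex.I ^ (k * (k + 1) / 2)) * ∑ i, (starRingEnd ℂ) (Gk.mulVec u i) * v i)
    -- `r` is a spacelike reflection
    (r : (Fin n → ℝ) →ₗ[ℝ] (Fin n → ℝ))
    (hr2 : ∀ v, r (r v) = v)
    (hrq : ∀ u v, q (r u) (r v) = q u v)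
    (hrpos : ∀ v : Fin n → ℝ, v ≠ 0 → 0 < q v (r v))
    -- `f` is a `q`-orthonormal basis of the `(−1)`-eigenspace of `r`
    (f : Fin k → (Fin n → ℝ))
    (hfeig : ∀ j, r (f j) = -(f j))
    (hforth : ∀ i j, q (f i) (f j) = if i = j then -1 else 0)
    (hfspan : ∀ v : Fin n → ℝ, r v = -v → v ∈ Submodule.span ℝ (Set.range f))
    (J : Matrix (Fin d) (Fin d) ℂ)
    (hJ : J = (Complex.I ^ (k * (k + 1) / 2)) •
      ((List.finRange k).map (fun j => ∑ i, (f j i : ℂ) • γ i)).prod) :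
    J * J = 1 ∧
    (∀ u v : Fin d → ℂ, krein (J.mulVec u) v = krein u (J.mulVec v)) ∧
    (∀ v : Fin n → ℝ,
      J * (∑ i, (v i : ℂ) • γ i) * J = (-1 : ℂ) ^ k • (∑ i, ((r v) i : ℂ) • γ i)) ∧
    (∃ ε : ℝ, (ε = 1 ∨ ε = -1) ∧ ∀ u : Fin d → ℂ, u ≠ 0 →
      0 < (krein u (((ε : ℂ) • J).mulVec u)).re ∧
        (krein u (((ε : ℂ) • J).mulVec u)).im = 0) := by
  obtain rfl : q = fun x y => ∑ i : Fin n, if (i : ℕ) < k then -(x i * y i) else x i * y i :=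
    funext fun x => funext fun y => hq x y
  clear hq
  set q : (Fin n → ℝ) → (Fin n → ℝ) → ℝ :=
    fun x y => ∑ i : Fin n, if (i : ℕ) < k then -(x i * y i) else x i * y i with hq
  set g := cliffordMap γ
  set s := standardReflection n k
  set c : ℂ := Complex.I ^ (k * (k + 1) / 2) with hc
  have hg : ∀ u v, g u * g v + g v * g u = (2 * (q u v : ℂ)) • 1 := cliffordMap_anticomm hcl
  have hqneg : ∀ u v, q (-u) v = -q u v := fun u v => by
    simp only [hq, Pi.neg_apply, ← Finset.sum_neg_distrib]
    refine Finset.sum_congr rfl fun i _ => ?_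
    split_ifs <;> ring
  have hqcomm : ∀ u v, q u v = q v u := fun u v => by simp only [hq, mul_comm]
  have hqs : ∀ u v, u ⬝ᵥ s v = q u v := fun u v => by
    simp only [hq, dotProduct, s, standardReflection_apply]
    refine Finset.sum_congr rfl fun i _ => ?_
    split_ifs <;> ring
  have hs2 : ∀ v, s (s v) = v := fun v => by
    ext i
    simp only [s, standardReflection_apply]
    split_ifs <;> simp
  have hsq : ∀ u v, q (s u) (s v) = q u v := fun u v => by
    rw [← hqs, hs2, dotProduct_comm, hqs, hqcomm]
  set e : Fin k → (Fin n → ℝ) := fun j => Pi.single (Fin.castLE hkn j) 1 with he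
  have hseig : ∀ j, s (e j) = -e j := fun j => by
    ext i
    simp only [s, standardReflection_apply, he, Pi.neg_apply, Pi.single_apply]
    by_cases h : i = Fin.castLE hkn j
    · simp [h]
    · simp [h]
  have heorth : ∀ i j, q (e i) (e j) = if i = j then -1 else 0 := fun i j => by
    rw [← hqs, hseig, he, single_dotProduct]
    simp only [Pi.neg_apply, Pi.single_apply, Fin.castLE_inj]
    split_ifs <;> simp
  have hespan : ∀ v, s v = -v → v ∈ Submodule.span ℝ (Set.range e) := fun v hv => by
    rw [pi_eq_sum_univ' v]
    refine Submodule.sum_mem _ fun i _ => ?_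
    by_cases hi : (i : ℕ) < k
    · exact Submodule.smul_mem _ _ (Submodule.subset_span ⟨⟨i, hi⟩, rfl⟩)
    · have h1 := congrFun hv i
      simp only [s, standardReflection_apply, if_neg hi, Pi.neg_apply, self_eq_neg] at h1
      rw [h1, zero_smul]
      exact Submodule.zero_mem _
  obtain ⟨J₀, hJ₀⟩ : ∃ K, K = c • Gk := ⟨_, rfl⟩
  have hJ₀' : J₀ = c • ((List.finRange k).map fun j => g (e j)).prod := by
    simp only [hJ₀, hGk, he, g, cliffordMap_single]
  have hsqJ : J * J = 1 := smul_prod_sq hg hforth hJ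
  have hsqJ₀ : J₀ * J₀ = 1 := smul_prod_sq hg heorth hJ₀'
  have hJg : ∀ v, J * g v = (-1 : ℂ) ^ k • (g (r v) * J) :=
    smul_prod_mul hg hqneg hforth r hr2 hrq hfeig hfspan hJ
  have hJ₀g : ∀ v, J₀ * g v = (-1 : ℂ) ^ k • (g (s v) * J₀) :=
    smul_prod_mul hg hqneg heorth s hs2 hsq hseig hespan hJ₀'
  have hself : ∀ f' : Fin k → (Fin n → ℝ), (∀ i j, q (f' i) (f' j) = if i = j then -1 else 0) →
      ∀ J', J' = c • ((List.finRange k).map fun j => g (f' j)).prod → J₀ * J' = J'ᴴ * J₀ := by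
    intro f' hf' J' hJ'
    refine mul_smul_prod_eq_conjTranspose_mul (by simp) (fun a ha => ?_)
      (pairwise_anticomm_of_orthonormal hg hf') hJ'
    obtain ⟨j, -, rfl⟩ := List.mem_map.1 ha
    rw [hJ₀g, conjTranspose_cliffordMap hadj]
  have hJJ : J₀ * J = Jᴴ * J₀ := hself f hforth J hJ
  have hJ₀H : J₀ᴴ = J₀ := by
    have := congrArg (· * J₀) (hself e heorth J₀ hJ₀')
    simpa [mul_assoc, hsqJ₀] using this.symm
  have hkr : ∀ u v, krein u v = (-1) ^ (k * (k + 1) / 2) * (star u ⬝ᵥ (J₀ *ᵥ v)) := fun u v => by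
    have h1 : (star u ⬝ᵥ (J₀ *ᵥ v)) = star (J₀ *ᵥ u) ⬝ᵥ v := by
      rw [star_mulVec, hJ₀H, dotProduct_mulVec]
    have h2 : krein u v = c * (star (Gk *ᵥ u) ⬝ᵥ v) := hkrein u v
    have h3 : (-1) ^ (k * (k + 1) / 2) * star c = c := by
      simp only [hc, star_pow, RCLike.star_def, Complex.conj_I, ← mul_pow]
      simp
    rw [h1, h2, hJ₀, smul_mulVec, star_smul, smul_dotProduct, smul_eq_mul, ← mul_assoc, h3]
  refine ⟨hsqJ, fun u v => ?_, fun v => ?_, ?_⟩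
  · rw [hkr, hkr, star_mulVec, ← dotProduct_mulVec, mulVec_mulVec, mulVec_mulVec, hJJ]
  · change J * g v * J = (-1 : ℂ) ^ k • g (r v)
    rw [hJg, smul_mul_assoc, mul_assoc, hsqJ, mul_one]
  obtain ⟨P, hP⟩ : ∃ P, P = J₀ * J := ⟨_, rfl⟩
  have hPH : P.IsHermitian := by
    rw [IsHermitian, hP, conjTranspose_mul, hJ₀H, hJJ]
  have hPinj : ∀ u, P *ᵥ u = 0 → u = 0 := fun u hu => by
    have h1 : (J * J₀) * P = 1 := by
      rw [hP, mul_assoc, ← mul_assoc J₀, hsqJ₀, one_mul, hsqJ]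
    rw [← one_mulVec u, ← h1, ← mulVec_mulVec, hu, mulVec_zero]
  have hPg : ∀ v, P * g v = g (s (r v)) * P := fun v => by
    rw [hP, mul_assoc, hJg, mul_smul_comm, ← mul_assoc, hJ₀g, smul_mul_assoc, smul_smul,
      ← mul_pow, mul_assoc]
    simp
  set M := LinearMap.toMatrix' (s ∘ₗ r) with hM
  have hMv : ∀ v, M *ᵥ v = s (r v) := fun v => by
    rw [hM, LinearMap.toMatrix'_mulVec, LinearMap.comp_apply]
  have hMpos : M.PosDef := by
    refine PosDef.of_dotProduct_mulVec_pos ?_ fun v hv => ?_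
    · ext i j
      have h1 : ∀ i j, M i j = q (Pi.single i 1) (r (Pi.single j 1)) := fun i j => by
        rw [← hqs, ← hMv]
        simp
      rw [conjTranspose_apply, star_trivial, h1, h1, ← hrq, hr2, hqcomm]
    · rw [hMv, star_trivial, hqs]
      exact hrpos v hv
  let b := hMpos.isHermitian.eigenvectorBasis
  have hadjoin : Algebra.adjoin ℂ (Set.range fun i => g (b i)) = ⊤ := by
    rw [eq_top_iff, ← hgen, Algebra.adjoin_le_iff]
    rintro _ ⟨j, rfl⟩
    have h1 : (Pi.single j 1 : Fin n → ℝ) =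
        ∑ i, inner ℝ (b i) (WithLp.toLp 2 (Pi.single j 1)) • ⇑(b i) := by
      have := congrArg WithLp.ofLp (b.sum_repr' (WithLp.toLp 2 (Pi.single j 1)))
      simpa using this.symm
    rw [← cliffordMap_single γ j, h1, map_sum]
    refine Subalgebra.sum_mem _ fun i _ => ?_
    rw [map_smulₛₗ]
    exact Subalgebra.smul_mem _ (Algebra.subset_adjoin (Set.mem_range_self i)) _
  have hdef := hPH.posDef_or_neg_posDef hPinj _ hadjoin hMpos.isHermitian.eigenvalues
    hMpos.eigenvalues_pos fun i => by
      rw [hPg, ← hMv, hMpos.isHermitian.mulVec_eigenvectorBasis i]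
      change g (_ • _) * P = _
      rw [map_smulₛₗ, smul_mul_assoc]
      rfl
  have hσ := neg_one_pow_eq_or ℝ (k * (k + 1) / 2)
  have hval : ∀ (ε : ℝ) u, krein u (((ε : ℂ) • J) *ᵥ u) =
      (((-1) ^ (k * (k + 1) / 2) * ε : ℝ) : ℂ) * (star u ⬝ᵥ (P *ᵥ u)) := fun ε u => by
    rw [hkr, smul_mulVec, mulVec_smul, mulVec_mulVec, dotProduct_smul, smul_eq_mul, hP]
    push_cast
    ring
  have hσ2 : (-1 : ℝ) ^ (k * (k + 1) / 2) * (-1) ^ (k * (k + 1) / 2) = 1 := by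
    rw [← mul_pow]
    simp
  rcases hdef with hdef | hdef
  · refine ⟨(-1) ^ (k * (k + 1) / 2), hσ, fun u hu => ?_⟩
    have h1 := hdef.re_pos_and_im_eq_zero hu
    rw [hval, hσ2, Complex.ofReal_one, one_mul]
    exact h1
  · refine ⟨-(-1) ^ (k * (k + 1) / 2), by rcases hσ with h | h <;> simp [h], fun u hu => ?_⟩
    have h1 := hdef.re_pos_and_im_eq_zero hu
    rw [neg_mulVec, dotProduct_neg] at h1
    rw [hval, mul_neg, hσ2, Complex.ofReal_neg, Complex.ofReal_one, neg_one_mul]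
    exact h1
end

section
/- Let n = 2m be even and 0 ≤ k ≤ n. Define Γ₁, …, Γₙ ∈ Mat(2^m, ℂ) by Γ_{2j−1} := τ(2j−1) · σ₃^{⊗(j−1)} ⊗ σ₁ ⊗ 1₂^{⊗(m−j)} and Γ_{2j} := τ(2j) · σ₃^{⊗(j−1)} ⊗ σ₂ ⊗ 1₂^{⊗(m−j)} for j = 1, …, m, where τ(a) = i if a ≤ k and τ(a) = 1 if a > k, σ₁, σ₂, σ₃ are the Pauli matrices, and ⊗ is the Kronecker product. Then (i) Γ_aΓ_b + Γ_bΓ_a = 2 q(e_a, e_b) · 1 for all a, b (where q is the signature-(n,k) form), and (ii) the algebra homomorphism Φ_{n,k} from the Clifford algebra of the quadratic form Q(z) = −z₁² − ⋯ − z_k² + z_{k+1}² + ⋯ + zₙ² on ℂⁿ to Mat(2^m, ℂ) induced by e_a ↦ Γ_a is an isomorphism of ℂ-algebras. -/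
open Matrix

/-- The Kronecker product of a finite family of square matrices. -/
def piKron {ι κ R : Type*} [Fintype ι] [CommSemiring R] (A : ι → Matrix κ κ R) :
    Matrix (ι → κ) (ι → κ) R :=
  Matrix.of fun x y => ∏ l, A l (x l) (y l)

section PiKron

variable {ι κ R : Type*} [Fintype ι] [CommRing R]

theorem piKron_mul [DecidableEq ι] [Fintype κ] (A B : ι → Matrix κ κ R) :
    piKron A * piKron B = piKron fun l => A l * B l := by
  ext x y
  simp only [piKron, Matrix.mul_apply, Matrix.of_apply, ← Finset.prod_mul_distrib]
  rw [Finset.prod_univ_sum, Fintype.piFinset_univ]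

theorem piKron_single [DecidableEq κ] (x y : ι → κ) :
    piKron (fun l => Matrix.single (x l) (y l) (1 : R)) = Matrix.single x y 1 := by
  ext x' y'
  simp only [piKron, Matrix.of_apply, Matrix.single_apply, Finset.prod_ite_zero,
    Finset.prod_const_one, Finset.mem_univ, true_implies, funext_iff, forall_and]

theorem piKron_one [DecidableEq κ] : piKron (fun _ : ι => (1 : Matrix κ κ R)) = 1 := by
  ext x y
  simp only [piKron, Matrix.of_apply, Matrix.one_apply, Finset.prod_ite_zero,
    Finset.prod_const_one, Finset.mem_univ, true_implies, funext_iff]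

variable [DecidableEq ι]

theorem piKron_update_apply (A : ι → Matrix κ κ R) (l : ι) (M : Matrix κ κ R) (x y : ι → κ) :
    piKron (Function.update A l M) x y =
      M (x l) (y l) * ∏ i ∈ Finset.univ.erase l, A i (x i) (y i) := by
  rw [piKron, Matrix.of_apply, ← Finset.mul_prod_erase _ _ (Finset.mem_univ l),
    Function.update_self]
  congr 1
  exact Finset.prod_congr rfl fun i hi => by
    rw [Function.update_of_ne (Finset.ne_of_mem_erase hi)]

theorem piKron_update_add (A : ι → Matrix κ κ R) (l : ι) (M N : Matrix κ κ R) :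
    piKron (Function.update A l (M + N)) =
      piKron (Function.update A l M) + piKron (Function.update A l N) := by
  ext x y
  simp only [Matrix.add_apply, piKron_update_apply, add_mul]

theorem piKron_update_smul (A : ι → Matrix κ κ R) (l : ι) (c : R) (M : Matrix κ κ R) :
    piKron (Function.update A l (c • M)) = c • piKron (Function.update A l M) := by
  ext x y
  simp only [Matrix.smul_apply, piKron_update_apply, smul_eq_mul, mul_assoc]

theorem piKron_eq_neg (A B : ι → Matrix κ κ R) (l : ι) (hl : A l = -B l)
    (h : ∀ i, i ≠ l → A i = B i) : piKron A = -piKron B := by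
  have hA : A = Function.update B l ((-1 : R) • B l) := by
    ext1 i
    by_cases hi : i = l
    · subst hi; simp [hl]
    · simp [hi, h i hi]
  rw [hA, piKron_update_smul, Function.update_eq_self, neg_one_smul]

end PiKron

section Span

variable {K A : Type*} [Field K] [Ring A] [Algebra K A]

/-- The span of the ordered products of distinct elements among `e 0, …, e (j - 1)`. -/
def orderedProductSpan (K : Type*) {A : Type*} [Field K] [Ring A] [Algebra K A] (e : ℕ → A) :
    ℕ → Submodule K A
  | 0 => Submodule.span K {1}
  | j + 1 => orderedProductSpan K e j ⊔
      (orderedProductSpan K e j).map (LinearMap.mulRight K (e j))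

theorem one_mem_orderedProductSpan (e : ℕ → A) (j : ℕ) : 1 ∈ orderedProductSpan K e j := by
  induction j with
  | zero => exact Submodule.mem_span_singleton_self 1
  | succ j ih => exact Submodule.mem_sup_left ih

theorem finite_orderedProductSpan (e : ℕ → A) (j : ℕ) :
    Module.Finite K (orderedProductSpan K e j) ∧
      Module.finrank K (orderedProductSpan K e j) ≤ 2 ^ j := by
  induction j with
  | zero =>
    refine ⟨inferInstanceAs (Module.Finite K (Submodule.span K {(1 : A)})), ?_⟩
    exact (finrank_span_le_card ({1} : Set A)).trans (by simp)
  | succ j ih =>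
    obtain ⟨_, hj⟩ := ih
    refine ⟨Submodule.finite_sup _ _, ?_⟩
    have h₁ := Submodule.finrank_add_le_finrank_add_finrank (orderedProductSpan K e j)
      ((orderedProductSpan K e j).map (LinearMap.mulRight K (e j)))
    have h₂ := Submodule.finrank_map_le (LinearMap.mulRight K (e j)) (orderedProductSpan K e j)
    rw [orderedProductSpan, pow_succ]
    lia

theorem mul_mem_orderedProductSpan (e : ℕ → A) (c : ℕ → K)
    (hsq : ∀ i, e i * e i = algebraMap K A (c i))
    (hanti : ∀ i j, i ≠ j → e j * e i = -(e i * e j)) (j : ℕ) :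
    ∀ i < j, ∀ s ∈ orderedProductSpan K e j, s * e i ∈ orderedProductSpan K e j := by
  induction j with
  | zero => intro i hi; lia
  | succ j ih =>
    intro i hi s hs
    obtain ⟨x, hx, _, ⟨y, hy, rfl⟩, rfl⟩ := Submodule.mem_sup.1 hs
    rw [add_mul, LinearMap.mulRight_apply, mul_assoc]
    by_cases hij : i = j
    · subst hij
      rw [hsq, ← Algebra.commutes, ← Algebra.smul_def]
      exact add_mem (Submodule.mem_sup_right ⟨x, hx, rfl⟩)
        (Submodule.mem_sup_left (Submodule.smul_mem _ _ hy))
    · have hi' : i < j := by lia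
      rw [hanti i j hij, mul_neg, ← mul_assoc]
      exact add_mem (Submodule.mem_sup_left (ih i hi' x hx))
        (neg_mem (Submodule.mem_sup_right ⟨_, ih i hi' y hy, rfl⟩))

end Span

theorem CliffordAlgebra.finite_and_finrank_le {K : Type*} [Field K] {n : ℕ}
    (Q : QuadraticForm K (Fin n → K))
    (hQ : ∀ i j : Fin n, i ≠ j → QuadraticMap.polar Q (Pi.single i 1) (Pi.single j 1) = 0) :
    Module.Finite K (CliffordAlgebra Q) ∧ Module.finrank K (CliffordAlgebra Q) ≤ 2 ^ n := by
  let e : ℕ → CliffordAlgebra Q := fun i =>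
    if h : i < n then CliffordAlgebra.ι Q (Pi.single ⟨i, h⟩ 1) else 0
  let c : ℕ → K := fun i => if h : i < n then Q (Pi.single ⟨i, h⟩ 1) else 0
  have hsq (i : ℕ) : e i * e i = algebraMap K _ (c i) := by
    by_cases h : i < n
    · simp [e, c, h]
    · simp [e, c, h]
  have hanti (i j : ℕ) (hij : i ≠ j) : e j * e i = -(e i * e j) := by
    by_cases hi : i < n
    · by_cases hj : j < n
      · simp only [e, hi, hj, dite_true]
        rw [eq_neg_iff_add_eq_zero, CliffordAlgebra.ι_mul_ι_add_swap, hQ, map_zero]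
        simpa using hij.symm
      · simp [e, hj]
    · simp [e, hi]
  have hι (v : Fin n → K) (s) (hs : s ∈ orderedProductSpan K e n) :
      s * CliffordAlgebra.ι Q v ∈ orderedProductSpan K e n := by
    rw [pi_eq_sum_univ' v, map_sum, Finset.mul_sum]
    refine sum_mem fun i _ => ?_
    have hi : CliffordAlgebra.ι Q (Pi.single i 1) = e i := by simp [e]
    rw [map_smul, mul_smul_comm, hi]
    exact Submodule.smul_mem _ _ (mul_mem_orderedProductSpan e c hsq hanti n i i.2 s hs)
  have htop : orderedProductSpan K e n = ⊤ := by
    refine eq_top_iff.2 fun x _ => ?_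
    suffices h : ∀ s ∈ orderedProductSpan K e n, s * x ∈ orderedProductSpan K e n by
      simpa using h 1 (one_mem_orderedProductSpan e n)
    induction x using CliffordAlgebra.induction with
    | algebraMap r =>
      intro s hs
      rw [← Algebra.commutes, ← Algebra.smul_def]
      exact Submodule.smul_mem _ _ hs
    | ι v => exact hι v
    | mul a b ha hb =>
      intro s hs
      rw [← mul_assoc]
      exact hb trivial _ (ha trivial s hs)
    | add a b ha hb =>
      intro s hs
      rw [mul_add]
      exact add_mem (ha trivial s hs) (hb trivial s hs)
  obtain ⟨h₁, h₂⟩ := finite_orderedProductSpan (K := K) e n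
  rw [htop] at h₁ h₂
  exact ⟨Module.Finite.equiv Submodule.topEquiv, by rwa [finrank_top] at h₂⟩

/-- The Pauli matrix `σ₁`. -/
def pauliX : Matrix (Fin 2) (Fin 2) ℂ := !![0, 1; 1, 0]

/-- The Pauli matrix `σ₂`. -/
def pauliY : Matrix (Fin 2) (Fin 2) ℂ := !![0, -Complex.I; Complex.I, 0]

/-- The Pauli matrix `σ₃`. -/
def pauliZ : Matrix (Fin 2) (Fin 2) ℂ := !![1, 0; 0, -1]

theorem pauliX_mul_self : pauliX * pauliX = 1 := by simp [pauliX, Matrix.one_fin_two]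

theorem pauliY_mul_self : pauliY * pauliY = 1 := by simp [pauliY, Matrix.one_fin_two]

theorem pauliZ_mul_self : pauliZ * pauliZ = 1 := by simp [pauliZ, Matrix.one_fin_two]

theorem pauliX_mul_pauliY : pauliX * pauliY = Complex.I • pauliZ := by
  simp [pauliX, pauliY, pauliZ]

theorem pauliY_mul_pauliX : pauliY * pauliX = -(pauliX * pauliY) := by
  simp [pauliX, pauliY]

theorem pauliZ_mul_pauliX : pauliZ * pauliX = -(pauliX * pauliZ) := by
  simp [pauliX, pauliZ]

theorem pauliZ_mul_pauliY : pauliZ * pauliY = -(pauliY * pauliZ) := by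
  simp [pauliY, pauliZ]

theorem eq_pauli_combination (M : Matrix (Fin 2) (Fin 2) ℂ) :
    M = ((M 0 0 + M 1 1) / 2) • (1 : Matrix (Fin 2) (Fin 2) ℂ) +
      ((M 0 1 + M 1 0) / 2) • pauliX + (Complex.I * (M 0 1 - M 1 0) / 2) • pauliY +
      ((M 0 0 - M 1 1) / 2) • pauliZ := by
  have hI := Complex.I_mul_I
  ext i j
  fin_cases i <;> fin_cases j <;> simp [pauliX, pauliY, pauliZ]
  · ring
  · linear_combination (M 0 1 - M 1 0) / 2 * hI
  · linear_combination -(M 0 1 - M 1 0) / 2 * hI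
  · ring

/-- The tensor factors of the `a`-th Jordan–Wigner matrix. -/
def jordanWignerFactor {m : ℕ} (a : ℕ) (l : Fin m) : Matrix (Fin 2) (Fin 2) ℂ :=
  if (l : ℕ) < a / 2 then pauliZ
  else if (l : ℕ) = a / 2 then (if a % 2 = 0 then pauliX else pauliY)
  else 1

theorem jordanWignerFactor_mul_self {m : ℕ} (a : ℕ) (l : Fin m) :
    jordanWignerFactor a l * jordanWignerFactor a l = 1 := by
  unfold jordanWignerFactor
  split_ifs <;> simp [pauliX_mul_self, pauliY_mul_self, pauliZ_mul_self]

theorem jordanWigner_mul_self {m : ℕ} (a : ℕ) :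
    piKron (jordanWignerFactor (m := m) a) * piKron (jordanWignerFactor a) = 1 := by
  simp only [piKron_mul, jordanWignerFactor_mul_self, piKron_one]

theorem jordanWigner_anticomm {m : ℕ} (a b : ℕ) (ha : a < 2 * m) (hab : a < b) :
    piKron (jordanWignerFactor (m := m) b) * piKron (jordanWignerFactor a) =
      -(piKron (jordanWignerFactor a) * piKron (jordanWignerFactor b)) := by
  rw [piKron_mul, piKron_mul]
  refine piKron_eq_neg _ _ ⟨a / 2, by lia⟩ ?_ fun i hi => ?_
  · rcases (Nat.div_le_div_right hab.le : a / 2 ≤ b / 2).lt_or_eq with h | h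
    · rcases Nat.mod_two_eq_zero_or_one a with ha' | ha' <;>
        simp [jordanWignerFactor, h, ha', pauliZ_mul_pauliX, pauliZ_mul_pauliY]
    · have ha' : a % 2 = 0 := by lia
      have hb' : b % 2 = 1 := by lia
      simp [jordanWignerFactor, ← h, ha', hb', pauliY_mul_pauliX]
  · rcases lt_or_gt_of_ne (fun h => hi (Fin.ext h) : (i : ℕ) ≠ a / 2) with h | h
    · have hb : (i : ℕ) < b / 2 := by lia
      simp [jordanWignerFactor, h, hb]
    · simp [jordanWignerFactor, h.not_gt, h.ne']

section Generation

variable {m : ℕ} (S : Subalgebra ℂ (Matrix (Fin m → Fin 2) (Fin m → Fin 2) ℂ))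

theorem piKron_update_mem (l : Fin m)
    (hX : piKron (Function.update (fun _ => 1) l pauliX) ∈ S)
    (hY : piKron (Function.update (fun _ => 1) l pauliY) ∈ S) (M : Matrix (Fin 2) (Fin 2) ℂ) :
    piKron (Function.update (fun _ => 1) l M) ∈ S := by
  have h1 : piKron (Function.update (fun _ : Fin m => (1 : Matrix (Fin 2) (Fin 2) ℂ)) l 1) ∈ S := by
    rw [Function.update_eq_self, piKron_one]
    exact one_mem S
  have hZ : piKron (Function.update (fun _ => 1) l pauliZ) ∈ S := by
    have h : pauliZ = (-Complex.I) • (pauliX * pauliY) := by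
      rw [pauliX_mul_pauliY, smul_smul]; simp
    have h' : piKron (Function.update (fun _ => 1) l (pauliX * pauliY)) =
        piKron (Function.update (fun _ => 1) l pauliX) *
          piKron (Function.update (fun _ => 1) l pauliY) := by
      rw [piKron_mul]
      congr 1
      ext1 i
      by_cases hi : i = l
      · subst hi; simp
      · simp [hi]
    rw [h, piKron_update_smul, h']
    exact S.smul_mem (mul_mem hX hY) _
  rw [eq_pauli_combination M]
  simp only [piKron_update_add, piKron_update_smul]
  exact add_mem (add_mem (add_mem (S.smul_mem h1 _) (S.smul_mem hX _)) (S.smul_mem hY _))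
    (S.smul_mem hZ _)

theorem piKron_truncate_succ (A : Fin m → Matrix (Fin 2) (Fin 2) ℂ) (j : ℕ) (hj : j < m) :
    piKron (fun l : Fin m => if (l : ℕ) < j + 1 then A l else 1) =
      piKron (fun l : Fin m => if (l : ℕ) < j then A l else 1) *
        piKron (Function.update (fun _ => 1) ⟨j, hj⟩ (A ⟨j, hj⟩)) := by
  rw [piKron_mul]
  congr 1
  ext1 i
  by_cases hi : i = ⟨j, hj⟩
  · subst hi; simp
  · have hi' : (i : ℕ) ≠ j := fun h => hi (Fin.ext h)
    have : (i : ℕ) < j + 1 ↔ (i : ℕ) < j := by lia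
    simp [hi, this]

theorem piKron_truncate_mem (A : Fin m → Matrix (Fin 2) (Fin 2) ℂ) (j : ℕ) (hj : j ≤ m)
    (hS : ∀ l : Fin m, (l : ℕ) < j → piKron (Function.update (fun _ => 1) l (A l)) ∈ S) :
    piKron (fun l : Fin m => if (l : ℕ) < j then A l else 1) ∈ S := by
  induction j with
  | zero => simp [piKron_one]
  | succ j ih =>
    rw [piKron_truncate_succ A j hj]
    exact mul_mem (ih (by lia) fun l hl => hS l (by lia)) (hS _ (Nat.lt_succ_self j))

theorem eq_top_of_jordanWigner_mem
    (hS : ∀ a < 2 * m, piKron (jordanWignerFactor (m := m) a) ∈ S) : S = ⊤ := by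
  have hsite (j : ℕ) (hj : j < m) (M) :
      piKron (Function.update (fun _ => 1) (⟨j, hj⟩ : Fin m) M) ∈ S := by
    induction j using Nat.strong_induction_on generalizing M with
    | _ j ih =>
    have hP := piKron_truncate_mem S (fun _ => pauliZ) j hj.le fun l hl => ih l hl l.2 _
    have key (a : ℕ) (haj : a / 2 = j) (P) (ha : (if a % 2 = 0 then pauliX else pauliY) = P) :
        piKron (Function.update (fun _ => 1) (⟨j, hj⟩ : Fin m) P) ∈ S := by
      convert mul_mem hP (hS a (by lia)) using 1
      rw [piKron_mul]
      congr 1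
      ext1 i
      rcases lt_trichotomy (i : ℕ) j with h | h | h
      · have hi : i ≠ ⟨j, hj⟩ := fun h' => h.ne (congrArg Fin.val h')
        simp [jordanWignerFactor, haj, h, hi, pauliZ_mul_self]
      · obtain rfl : i = ⟨j, hj⟩ := Fin.ext h
        simp [jordanWignerFactor, haj, ha]
      · have hi : i ≠ ⟨j, hj⟩ := fun h' => h.ne' (congrArg Fin.val h')
        simp [jordanWignerFactor, haj, h.not_gt, h.ne', hi]
    exact piKron_update_mem S _ (key (2 * j) (by lia) _ (by simp))
      (key (2 * j + 1) (by lia) _ (by simp [Nat.add_mod])) M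
  have hkron (A : Fin m → Matrix (Fin 2) (Fin 2) ℂ) : piKron A ∈ S := by
    simpa only [Fin.is_lt, if_true] using piKron_truncate_mem S A m le_rfl fun l _ => hsite l l.2 _
  refine eq_top_iff.2 fun M _ => ?_
  rw [Matrix.matrix_eq_sum_single M]
  refine sum_mem fun x _ => sum_mem fun y _ => ?_
  have h : Matrix.single x y (M x y) = M x y • Matrix.single x y (1 : ℂ) := by
    simp [Matrix.smul_single]
  rw [h, ← piKron_single]
  exact S.smul_mem (hkron _) _

end Generation

/-- the Pauli-matrix construction of the Clifford representation.
For `n = 2m`, the iterated Kronecker products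
`Γ_{2j−1} = τ(2j−1)·σ₃^{⊗(j−1)} ⊗ σ₁ ⊗ 1^{⊗(m−j)}` and
`Γ_{2j} = τ(2j)·σ₃^{⊗(j−1)} ⊗ σ₂ ⊗ 1^{⊗(m−j)}` (realized here as matrices
indexed by `Fin m → Fin 2`, with `(A₁⊗⋯⊗A_m)(x,y) = ∏ l, A_l (x l) (y l)`)
satisfy the signature-`(n,k)` Clifford relations, and the induced algebra
homomorphism `Φ_{n,k} : Cl(Q) → Mat(2^m, ℂ)` is an isomorphism. -/
theorem pauli_clifford_representation_iso
    (n m k : ℕ) (hnm : n = 2 * m) (hkn : k ≤ n)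
    (σ₁ σ₂ σ₃ : Matrix (Fin 2) (Fin 2) ℂ)
    (hσ₁ : σ₁ = !![0, 1; 1, 0])
    (hσ₂ : σ₂ = !![0, -Complex.I; Complex.I, 0])
    (hσ₃ : σ₃ = !![1, 0; 0, -1])
    (Γ : Fin n → Matrix (Fin m → Fin 2) (Fin m → Fin 2) ℂ)
    (hΓ : ∀ (a : Fin n) (x y : Fin m → Fin 2), Γ a x y =
      (if (a : ℕ) < k then Complex.I else 1) *
        ∏ l : Fin m,
          (if (l : ℕ) < (a : ℕ) / 2 then σ₃
            else if (l : ℕ) = (a : ℕ) / 2 then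
              (if (a : ℕ) % 2 = 0 then σ₁ else σ₂)
            else 1) (x l) (y l))
    (Q : QuadraticForm ℂ (Fin n → ℂ))
    (hQ : ∀ z : Fin n → ℂ, Q z =
      ∑ i : Fin n, (if (i : ℕ) < k then -1 else 1) * (z i * z i))
    (Φ : CliffordAlgebra Q →ₐ[ℂ] Matrix (Fin m → Fin 2) (Fin m → Fin 2) ℂ)
    (hΦ : ∀ a : Fin n, Φ (CliffordAlgebra.ι Q (Pi.single a 1)) = Γ a) :
    (∀ a b : Fin n, Γ a * Γ b + Γ b * Γ a =
      ((2 : ℂ) * (if a = b then (if (a : ℕ) < k then -1 else 1) else 0)) •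
        (1 : Matrix (Fin m → Fin 2) (Fin m → Fin 2) ℂ)) ∧
    Function.Bijective Φ := by
  subst hnm
  obtain rfl : σ₁ = pauliX := hσ₁
  obtain rfl : σ₂ = pauliY := hσ₂
  obtain rfl : σ₃ = pauliZ := hσ₃
  have hΓ' (a : Fin (2 * m)) : Γ a =
      (if (a : ℕ) < k then Complex.I else 1) • piKron (jordanWignerFactor (m := m) a) := by
    ext x y
    rw [hΓ]
    rfl
  refine ⟨fun a b => ?_, ?_⟩
  · rw [hΓ' a, hΓ' b, smul_mul_smul_comm, smul_mul_smul_comm]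
    rcases lt_trichotomy a b with h | h | h
    · rw [jordanWigner_anticomm a b a.2 h, if_neg h.ne, mul_comm]
      simp
    · subst h
      rw [jordanWigner_mul_self, ← add_smul]
      congr 1
      rw [if_pos rfl]
      split_ifs
      · linear_combination 2 * Complex.I_mul_I
      · norm_num
    · rw [jordanWigner_anticomm b a b.2 h, if_neg h.ne', mul_comm]
      simp
  have hsurj : Function.Surjective Φ := by
    rw [← AlgHom.range_eq_top]
    refine eq_top_of_jordanWigner_mem _ fun a ha => ?_
    have h : piKron (jordanWignerFactor (m := m) a) =
        (if a < k then Complex.I else 1)⁻¹ • Γ ⟨a, ha⟩ := by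
      rw [hΓ', inv_smul_smul₀]
      split_ifs <;> simp
    rw [h, ← hΦ]
    exact Subalgebra.smul_mem _ (AlgHom.mem_range_self Φ _) _
  have hpolar (i j : Fin (2 * m)) (hij : i ≠ j) :
      QuadraticMap.polar Q (Pi.single i 1) (Pi.single j 1) = 0 := by
    rw [QuadraticMap.polar, hQ, hQ, hQ, ← Finset.sum_sub_distrib, ← Finset.sum_sub_distrib]
    refine Finset.sum_eq_zero fun l _ => ?_
    by_cases hi : l = i
    · subst hi
      simp [hij]
    · simp [hi]
  obtain ⟨_, hle⟩ := CliffordAlgebra.finite_and_finrank_le Q hpolar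
  have hmat : Module.finrank ℂ (Matrix (Fin m → Fin 2) (Fin m → Fin 2) ℂ) = 2 ^ (2 * m) := by
    simp [Module.finrank_matrix, two_mul, pow_add]
  have hge := LinearMap.finrank_le_finrank_of_surjective (f := Φ.toLinearMap) hsurj
  have heq := le_antisymm (hle.trans hmat.ge) hge
  exact ⟨(LinearMap.injective_iff_surjective_of_finrank_eq_finrank heq
    (f := Φ.toLinearMap)).2 hsurj, hsurj⟩
end
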